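/- Let f, g : X → X be distinct bijections of a set X and let π = {(x, f(x)) : x ∈ X} and ρ = {(x, g(x)) : x ∈ X} be their graphs, regarded as binary relations on X. Then there exists γ with π ⊆ γ and γ ≤ ρ in Mitsch's natural partial order, but there is no α with π ≤ α (Mitsch order) and α ⊆ ρ. Hence the composite ≤∘⊆ is properly contained in ⊆∘≤ on B_X. -/

import Mathlib

/-- Left-to-right composition of binary relations on `X`:
`rcomp a b = {(x,z) : ∃ y, (x,y) ∈ a ∧ (y,z) ∈ b}`. -/
def rcomp {X : Type*} (a b : Set (X × X)) : Set (X × X) :=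
  {p | ∃ y, (p.1, y) ∈ a ∧ (y, p.2) ∈ b}

/-- Converse of a binary relation. -/
def rconv {X : Type*} (a : Set (X × X)) : Set (X × X) :=
  {p | (p.2, p.1) ∈ a}

/-- Mitsch's natural partial order on the monoid of binary relations:
`a ≤ b` iff `a = b` or there are `ξ, η` with `a = aξ = bξ = ηb`. -/
def mitschLe {X : Type*} (a b : Set (X × X)) : Prop :=
  a = b ∨ ∃ ξ η : Set (X × X), a = rcomp a ξ ∧ a = rcomp b ξ ∧ a = rcomp η b

/-- The rectangle `dom b × im b` lies below `b` in Mitsch's order. -/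
theorem mitschLe_dom_prod_im {X : Type*} (b : Set (X × X)) :
    mitschLe ((Prod.fst '' b) ×ˢ (Prod.snd '' b)) b := by
  refine Or.inr ⟨Set.univ ×ˢ (Prod.snd '' b), (Prod.fst '' b) ×ˢ Set.univ, ?_, ?_, ?_⟩ <;>
    ext ⟨x, z⟩
  · simp [rcomp]
    grind
  · simp [rcomp]
  · simp [rcomp]

/-- A relation below `c` in Mitsch's order is contained in the rectangle `dom c × im c`. -/
theorem mitschLe.subset_dom_prod_im {X : Type*} {a c : Set (X × X)} (h : mitschLe a c) :
    a ⊆ (Prod.fst '' c) ×ˢ (Prod.snd '' c) := by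
  rintro ⟨x, z⟩ hp
  rcases h with rfl | ⟨ξ, η, -, h₁, h₂⟩
  · exact ⟨⟨_, hp, rfl⟩, ⟨_, hp, rfl⟩⟩
  · obtain ⟨y, hy, -⟩ := h₁ ▸ hp
    obtain ⟨w, -, hw⟩ := h₂ ▸ hp
    exact ⟨⟨_, hy, rfl⟩, ⟨_, hw, rfl⟩⟩

/-- The composite `≤∘⊆` is contained in `⊆∘≤`. -/
theorem exists_subset_mitschLe {X : Type*} {a b c : Set (X × X)} (hac : mitschLe a c)
    (hcb : c ⊆ b) : ∃ d, a ⊆ d ∧ mitschLe d b :=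
  ⟨_, hac.subset_dom_prod_im.trans
    (Set.prod_mono (Set.image_mono hcb) (Set.image_mono hcb)), mitschLe_dom_prod_im b⟩

/-- If the graph of a surjection `f` is Mitsch-below a subset of the graph of `g`, then
`f = g`. -/
theorem eq_of_graph_mitschLe {X : Type*} {f g : X → X} (hf : Function.Surjective f)
    {a : Set (X × X)} (h : mitschLe {p : X × X | p.2 = f p.1} a)
    (ha : a ⊆ {p : X × X | p.2 = g p.1}) : f = g := by
  funext x
  rcases h with rfl | ⟨ξ, η, h₁, h₂, -⟩
  · exact ha (show (x, f x) ∈ {p : X × X | p.2 = f p.1} from rfl)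
  · have graph_mem (t : X) : (t, f t) ∈ {p : X × X | p.2 = f p.1} := rfl
    obtain ⟨y, hy, -⟩ := h₂.subset (graph_mem x)
    obtain ⟨t, rfl⟩ := hf y
    obtain ⟨w, hw, hwt⟩ := h₁.subset (graph_mem t)
    obtain rfl : w = f t := hw
    have hx : (x, f t) ∈ {p : X × X | p.2 = f p.1} := h₂.superset ⟨f t, hy, hwt⟩
    exact (Eq.symm hx).trans (ha hy)

/-- For graphs π, ρ of distinct bijections: (π, ρ) lies in ⊆∘≤ but not in ≤∘⊆;
hence ≤∘⊆ is properly contained in ⊆∘≤. -/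
theorem stmt15 {X : Type*} (f g : X → X) (hf : Function.Bijective f)
    (hg : Function.Bijective g) (hfg : f ≠ g) :
    (∃ γ : Set (X × X), {p : X × X | p.2 = f p.1} ⊆ γ ∧
        mitschLe γ {p : X × X | p.2 = g p.1}) ∧
    (¬ ∃ α : Set (X × X), mitschLe {p : X × X | p.2 = f p.1} α ∧
        α ⊆ {p : X × X | p.2 = g p.1}) ∧
    {q : Set (X × X) × Set (X × X) | ∃ c, mitschLe q.1 c ∧ c ⊆ q.2} ⊂
      {q : Set (X × X) × Set (X × X) | ∃ c, q.1 ⊆ c ∧ mitschLe c q.2} := by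
  set π : Set (X × X) := {p | p.2 = f p.1}
  set ρ : Set (X × X) := {p | p.2 = g p.1}
  have hγ : ∃ γ, π ⊆ γ ∧ mitschLe γ ρ := by
    refine ⟨_, ?_, mitschLe_dom_prod_im ρ⟩
    rintro ⟨x, z⟩ -
    obtain ⟨y, rfl⟩ := hg.surjective z
    exact ⟨⟨(x, g x), rfl, rfl⟩, ⟨(y, g y), rfl, rfl⟩⟩
  have hα : ¬ ∃ α, mitschLe π α ∧ α ⊆ ρ := fun ⟨_, h, hα⟩ =>
    hfg (eq_of_graph_mitschLe hf.surjective h hα)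
  refine ⟨hγ, hα, fun _ ⟨_, h, hc⟩ => exists_subset_mitschLe h hc, fun h => ?_⟩
  exact hα (h (show (π, ρ) ∈ _ from hγ))
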